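/- Let R be a subdirect product of finite regular SMB algebras A₁, ..., Aₙ with Rees congruences θ₁, ..., θₙ, let I_R = {(i, α, β) : 1 ≤ i ≤ n, α ≺ β ≤ θᵢ in Con(Aᵢ)}. Then the relation "cannot be separated with respect to R" is an equivalence relation on I_R (it is reflexive, transitive, and symmetric). -/

import Mathlib

/-- A semilattice of Mal'cev blocks (SMB algebra): an idempotent algebra `(A; ∧, d)`
together with a congruence `sim` such that the quotient is a semilattice under `∧`,
and on each `sim`-class `∧` is first projection and `d` is Mal'cev. -/
structure SMB (A : Type) where
  meet : A → A → A
  d : A → A → A → A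
  sim : A → A → Prop
  sim_equiv : Equivalence sim
  sim_meet : ∀ {a b a' b'}, sim a a' → sim b b' → sim (meet a b) (meet a' b')
  sim_d : ∀ {a b c a' b' c'}, sim a a' → sim b b' → sim c c' → sim (d a b c) (d a' b' c')
  meet_idem : ∀ a, meet a a = a
  d_idem : ∀ a, d a a a = a
  meet_comm_sim : ∀ a b, sim (meet a b) (meet b a)
  meet_assoc_sim : ∀ a b c, sim (meet (meet a b) c) (meet a (meet b c))
  meet_proj : ∀ {a b}, sim a b → meet a b = a
  malcev_left : ∀ {a b}, sim a b → d a a b = b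
  malcev_right : ∀ {a b}, sim a b → d b a a = b

/-- A regular SMB algebra. -/
structure RegSMB (A : Type) extends SMB A where
  reg1 : ∀ a b c, sim (d a b c) (meet (meet a b) c)
  reg2 : ∀ a b, sim (meet a b) a → meet a b = a
  reg3 : ∀ x y z, d x y z = d (meet x (meet z y)) (meet y (meet z x)) (meet z (meet y x))
  reg4 : ∀ x y, meet x (meet x y) = meet x y

/-- `M` is the least `sim`-class of the SMB algebra `S`. -/
def SMB.IsMinClass {A : Type} (S : SMB A) (M : Set A) : Prop :=
  ∃ m, M = {x | S.sim x m} ∧ ∀ b, S.sim (S.meet m b) m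

/-- A congruence of an SMB algebra. -/
def SMB.IsCong {A : Type} (S : SMB A) (θ : A → A → Prop) : Prop :=
  Equivalence θ ∧
  (∀ a b a' b', θ a a' → θ b b' → θ (S.meet a b) (S.meet a' b')) ∧
  (∀ a b c a' b' c', θ a a' → θ b b' → θ c c' → θ (S.d a b c) (S.d a' b' c'))

def CongLE {A : Type} (α β : A → A → Prop) : Prop := ∀ a b, α a b → β a b

/-- `α ≺ β`: a covering pair of congruences. -/
def SMB.IsCover {A : Type} (S : SMB A) (α β : A → A → Prop) : Prop :=
  S.IsCong α ∧ S.IsCong β ∧ CongLE α β ∧ ¬ CongLE β α ∧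
  ∀ γ, S.IsCong γ → CongLE α γ → CongLE γ β → (CongLE γ α ∨ CongLE β γ)

/-- The Rees congruence `Δ ∪ M × M` of the least class `M`. -/
def reesCong {A : Type} (M : Set A) : A → A → Prop := fun a b => a = b ∨ (a ∈ M ∧ b ∈ M)

/-- Syntactic unary polynomials over the SMB signature with constants from `K`. -/
inductive PTerm (K : Type) : Type
  | var : PTerm K
  | const : K → PTerm K
  | meet : PTerm K → PTerm K → PTerm K
  | dd : PTerm K → PTerm K → PTerm K → PTerm K

def PTerm.eval {A K : Type} (S : SMB A) (κ : K → A) : PTerm K → A → A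
  | .var => fun x => x
  | .const k => fun _ => κ k
  | .meet p q => fun x => S.meet (p.eval S κ x) (q.eval S κ x)
  | .dd p q r => fun x => S.d (p.eval S κ x) (q.eval S κ x) (r.eval S κ x)

def MapsC {A B : Type} (f : A → B) (θ : A → A → Prop) (θ' : B → B → Prop) : Prop :=
  ∀ a b, θ a b → θ' (f a) (f b)

/-- `R` is a subdirect subuniverse of the product of the `A i`. -/
def SubdirectSMB {n : ℕ} {A : Fin n → Type} (S : ∀ i, SMB (A i)) (R : Set (∀ i, A i)) : Prop :=
  (∀ r ∈ R, ∀ s ∈ R, (fun i => (S i).meet (r i) (s i)) ∈ R) ∧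
  (∀ r ∈ R, ∀ s ∈ R, ∀ u ∈ R, (fun i => (S i).d (r i) (s i) (u i)) ∈ R) ∧
  (∀ i x, ∃ r ∈ R, r i = x)

/-- The `k`-th coordinate polynomial of a unary polynomial of `R` (given by a
syntactic polynomial with constants from `R`). -/
def coordEval {n : ℕ} {A : Fin n → Type} (S : ∀ i, SMB (A i)) (R : Set (∀ i, A i))
    (p : PTerm {r : ∀ i, A i // r ∈ R}) (k : Fin n) : A k → A k :=
  PTerm.eval (S k) (fun r => r.1 k) p

/-- `(i, α, β)` can be separated from `(j, γ, δ)` with respect to `R`. -/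
def SepWrt {n : ℕ} {A : Fin n → Type} (S : ∀ i, SMB (A i)) (R : Set (∀ i, A i))
    (i : Fin n) (α β : A i → A i → Prop) (j : Fin n) (γ δ : A j → A j → Prop) : Prop :=
  ∃ p : PTerm {r : ∀ i, A i // r ∈ R},
    ¬ MapsC (coordEval S R p i) β α ∧ MapsC (coordEval S R p j) δ γ

/-- `a` is an `αβ`-split element. -/
def SMB.IsSplit {A : Type} (S : SMB A) (α β : A → A → Prop) (a : A) : Prop :=
  ∃ b c, β b c ∧ ¬ α (S.meet a b) (S.meet a c)

/-- Unary polynomials of a single SMB algebra. -/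
def SMB.Pol1 {A : Type} (S : SMB A) (f : A → A) : Prop :=
  ∃ p : PTerm A, f = PTerm.eval S id p

/-- `(α,β)`-minimal sets of an SMB algebra. -/
def SMB.IsMinSet {A : Type} (S : SMB A) (α β : A → A → Prop) (U : Set A) : Prop :=
  ∃ f, S.Pol1 f ∧ Set.range f = U ∧ ¬ MapsC f β α ∧
    ∀ g, S.Pol1 g → ¬ MapsC g β α → Set.range g ⊆ U → Set.range g = U

/-- Membership of the triple `(i, α, β)` in `I_R`: `α ≺ β ≤ θᵢ`. -/
def InIR {n : ℕ} {A : Fin n → Type} (S : ∀ i, RegSMB (A i)) (M : ∀ i, Set (A i))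
    (i : Fin n) (α β : A i → A i → Prop) : Prop :=
  SMB.IsCover (S i).toSMB α β ∧ CongLE β (reesCong (M i))

namespace PTerm

/-- Substitution of `q` for the variable of a syntactic polynomial. -/
def comp {K : Type} : PTerm K → PTerm K → PTerm K
  | .var, q => q
  | .const k, _ => .const k
  | .meet s t, q => .meet (s.comp q) (t.comp q)
  | .dd s t u, q => .dd (s.comp q) (t.comp q) (u.comp q)

/-- Renaming of the constants of a syntactic polynomial. -/
def map {K L : Type} (σ : K → L) : PTerm K → PTerm L
  | .var => .var
  | .const k => .const (σ k)
  | .meet s t => .meet (s.map σ) (t.map σ)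
  | .dd s t u => .dd (s.map σ) (t.map σ) (u.map σ)

theorem eval_comp {A K : Type} (S : SMB A) (κ : K → A) (p q : PTerm K) (x : A) :
    (p.comp q).eval S κ x = p.eval S κ (q.eval S κ x) := by
  induction p with
  | var => rfl
  | const k => rfl
  | meet s t hs ht => simp only [comp, eval, hs, ht]
  | dd s t u hs ht hu => simp only [comp, eval, hs, ht, hu]

theorem eval_map {A K L : Type} (S : SMB A) (σ : K → L) (κ : L → A) (p : PTerm K) (x : A) :
    (p.map σ).eval S κ x = p.eval S (κ ∘ σ) x := by
  induction p with
  | var => rfl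
  | const k => rfl
  | meet s t hs ht => simp only [map, eval, hs, ht]
  | dd s t u hs ht hu => simp only [map, eval, hs, ht, hu]

theorem eval_cong {A K : Type} {S : SMB A} {θ : A → A → Prop} (hθ : S.IsCong θ) (κ : K → A)
    (p : PTerm K) {x y : A} (h : θ x y) : θ (p.eval S κ x) (p.eval S κ y) := by
  induction p with
  | var => exact h
  | const k => exact hθ.1.refl _
  | meet s t hs ht => exact hθ.2.1 _ _ _ _ hs ht
  | dd s t u hs ht hu => exact hθ.2.2 _ _ _ _ _ _ hs ht hu

end PTerm

theorem SMB.IsMinClass.nonempty {A : Type} {S : SMB A} {M : Set A} (hM : S.IsMinClass M) :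
    M.Nonempty := by
  obtain ⟨m, rfl, -⟩ := hM
  exact ⟨m, S.sim_equiv.refl m⟩

theorem SMB.IsMinClass.sim {A : Type} {S : SMB A} {M : Set A} (hM : S.IsMinClass M) {x y : A}
    (hx : x ∈ M) (hy : y ∈ M) : S.sim x y := by
  obtain ⟨m, rfl, -⟩ := hM
  exact S.sim_equiv.trans hx (S.sim_equiv.symm hy)

theorem SMB.IsMinClass.meet_left_mem {A : Type} {S : SMB A} {M : Set A} (hM : S.IsMinClass M)
    {x : A} (hx : x ∈ M) (b : A) : S.meet x b ∈ M := by
  obtain ⟨m, rfl, hm⟩ := hM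
  exact S.sim_equiv.trans (S.sim_meet hx (S.sim_equiv.refl b)) (hm b)

theorem SMB.IsMinClass.meet_right_mem {A : Type} {S : SMB A} {M : Set A} (hM : S.IsMinClass M)
    {x : A} (hx : x ∈ M) (b : A) : S.meet b x ∈ M := by
  have h := hM.meet_left_mem hx b
  obtain ⟨m, rfl, -⟩ := hM
  exact S.sim_equiv.trans (S.meet_comm_sim b x) h

theorem mem_of_le_reesCong {A : Type} {M : Set A} {β : A → A → Prop}
    (hβ : CongLE β (reesCong M)) {x y : A} (h : β x y) (hne : x ≠ y) : x ∈ M ∧ y ∈ M :=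
  (hβ x y h).resolve_left hne

/-- Below the Rees congruence of the least class, a pair of `β` outside `α` is carried by
unary polynomials onto every pair of `β`, up to `α`, whenever `α ≺ β`. -/
theorem SMB.IsCover.exists_polynomial {A : Type} {S : SMB A} {M : Set A}
    (hM : S.IsMinClass M) {α β : A → A → Prop} (hc : S.IsCover α β)
    (hβ : CongLE β (reesCong M)) {a b : A} (hab : β a b) (hnab : ¬ α a b)
    {x y : A} (hxy : β x y) :
    ∃ g : PTerm A, α (g.eval S id a) x ∧ α (g.eval S id b) y := by
  obtain ⟨hα, hβc, hle, -, hcov⟩ := hc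
  set T : A → A → Prop := fun x y =>
    ∃ g : PTerm A, α (g.eval S id a) x ∧ α (g.eval S id b) y
  have Trefl : ∀ x, T x x := fun x => ⟨.const x, hα.1.refl _, hα.1.refl _⟩
  have Tmeet : ∀ x y x' y', T x x' → T y y' → T (S.meet x y) (S.meet x' y') := by
    rintro x y x' y' ⟨g, hg, hg'⟩ ⟨h, hh, hh'⟩
    exact ⟨.meet g h, hα.2.1 _ _ _ _ hg hh, hα.2.1 _ _ _ _ hg' hh'⟩
  have Td : ∀ x y z x' y' z', T x x' → T y y' → T z z' → T (S.d x y z) (S.d x' y' z') := by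
    rintro x y z x' y' z' ⟨g, hg, hg'⟩ ⟨h, hh, hh'⟩ ⟨k, hk, hk'⟩
    exact ⟨.dd g h k, hα.2.2 _ _ _ _ _ _ hg hh hk, hα.2.2 _ _ _ _ _ _ hg' hh' hk'⟩
  have hη : S.IsCong (fun x y => T x y ∧ β x y) := by
    refine ⟨⟨fun x => ⟨Trefl x, hβc.1.refl x⟩, ?_, ?_⟩, ?_, ?_⟩
    · rintro x y ⟨hxy, hb⟩
      refine ⟨?_, hβc.1.symm hb⟩
      rcases eq_or_ne x y with rfl | hne
      · exact hxy
      obtain ⟨hx, hy⟩ := mem_of_le_reesCong hβ hb hne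
      have h := Td _ _ _ _ _ _ (Trefl x) hxy (Trefl y)
      rwa [S.malcev_left (hM.sim hx hy), S.malcev_right (hM.sim hy hx)] at h
    · rintro x y z ⟨hxy, hb⟩ ⟨hyz, hb'⟩
      refine ⟨?_, hβc.1.trans hb hb'⟩
      rcases eq_or_ne x y with rfl | hne
      · exact hyz
      rcases eq_or_ne y z with rfl | hne'
      · exact hxy
      obtain ⟨hx, hy⟩ := mem_of_le_reesCong hβ hb hne
      obtain ⟨-, hz⟩ := mem_of_le_reesCong hβ hb' hne'
      have h := Td _ _ _ _ _ _ hxy (Trefl y) hyz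
      rwa [S.malcev_left (hM.sim hy hz), S.malcev_right (hM.sim hy hx)] at h
    · rintro x y x' y' ⟨h, hb⟩ ⟨h', hb'⟩
      exact ⟨Tmeet _ _ _ _ h h', hβc.2.1 _ _ _ _ hb hb'⟩
    · rintro x y z x' y' z' ⟨h, hb⟩ ⟨h', hb'⟩ ⟨h'', hb''⟩
      exact ⟨Td _ _ _ _ _ _ h h' h'', hβc.2.2 _ _ _ _ _ _ hb hb' hb''⟩
  rcases hcov _ hη (fun x y h => ⟨⟨.const x, hα.1.refl _, h⟩, hle _ _ h⟩) (fun _ _ h => h.2)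
    with h | h
  · exact absurd (h a b ⟨⟨.var, hα.1.refl _, hα.1.refl _⟩, hab⟩) hnab
  · exact (h x y hxy).1

section Subdirect

variable {n : ℕ} {A : Fin n → Type} {S : ∀ i, SMB (A i)} {R : Set (∀ i, A i)}

theorem coordEval_comp (p q : PTerm {r : ∀ i, A i // r ∈ R}) (k : Fin n) (x : A k) :
    coordEval S R (p.comp q) k x = coordEval S R p k (coordEval S R q k x) :=
  PTerm.eval_comp _ _ _ _ _

theorem coordEval_cong {k : Fin n} {θ : A k → A k → Prop} (hθ : (S k).IsCong θ)
    (p : PTerm {r : ∀ i, A i // r ∈ R}) {x y : A k} (h : θ x y) :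
    θ (coordEval S R p k x) (coordEval S R p k y) :=
  PTerm.eval_cong hθ _ p h

/-- Every unary polynomial of a coordinate algebra is induced by one of `R`. -/
theorem SubdirectSMB.exists_lift (hR : SubdirectSMB S R) (j : Fin n) (g : PTerm (A j)) :
    ∃ p : PTerm {r : ∀ i, A i // r ∈ R}, ∀ x, coordEval S R p j x = g.eval (S j) id x := by
  choose σ hσ hσ' using hR.2.2 j
  refine ⟨g.map fun a => ⟨σ a, hσ a⟩, fun x => ?_⟩
  rw [coordEval, PTerm.eval_map]
  congr 1
  exact funext hσ'

/-- `R` has an element lying in the least class at two given coordinates. -/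
theorem SubdirectSMB.exists_mem_min (hR : SubdirectSMB S R) {M : ∀ i, Set (A i)}
    (hM : ∀ i, (S i).IsMinClass (M i)) (i j : Fin n) : ∃ m ∈ R, m i ∈ M i ∧ m j ∈ M j := by
  obtain ⟨x, hx⟩ := (hM i).nonempty
  obtain ⟨y, hy⟩ := (hM j).nonempty
  obtain ⟨r, hr, rfl⟩ := hR.2.2 i x
  obtain ⟨s, hs, rfl⟩ := hR.2.2 j y
  exact ⟨_, hR.1 r hr s hs, (hM i).meet_left_mem hx _, (hM j).meet_right_mem hy _⟩

/-- If `p` collapses `β` into `α` but not `δ` into `γ`, then any pair `(a, b)` in `δ` outside `γ`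
is fixed modulo `γ` by a polynomial collapsing `β` into `α`, with values in the least classes. -/
theorem SubdirectSMB.exists_collapsing_retraction (hR : SubdirectSMB S R) {M : ∀ i, Set (A i)}
    (hM : ∀ i, (S i).IsMinClass (M i)) {i j : Fin n} {α β : A i → A i → Prop}
    {γ δ : A j → A j → Prop} (hα : (S i).IsCong α) (hβ : (S i).IsCong β)
    (hc : (S j).IsCover γ δ) (hδ : CongLE δ (reesCong (M j)))
    {p : PTerm {r : ∀ i, A i // r ∈ R}} (hpj : ¬ MapsC (coordEval S R p j) δ γ)
    (hpi : MapsC (coordEval S R p i) β α) {a b : A j} (hab : δ a b) (hnab : ¬ γ a b) :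
    ∃ P : PTerm {r : ∀ i, A i // r ∈ R}, MapsC (coordEval S R P i) β α ∧
      (∀ x, coordEval S R P i x ∈ M i) ∧ (∀ x, coordEval S R P j x ∈ M j) ∧
      γ (coordEval S R P j a) a ∧ γ (coordEval S R P j b) b := by
  have hγ := hc.1
  unfold MapsC at hpj
  push Not at hpj
  obtain ⟨a', b', hab', hnab'⟩ := hpj
  obtain ⟨h, hha, hhb⟩ := hc.exists_polynomial (hM j) hδ hab hnab hab'
  obtain ⟨h, hh⟩ := hR.exists_lift j h
  rw [← hh] at hha hhb
  have hpa := coordEval_cong hγ p hha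
  have hpb := coordEval_cong hγ p hhb
  have hpab := coordEval_cong hc.2.1 p hab'
  obtain ⟨g, hga, hgb⟩ := hc.exists_polynomial (hM j) hδ hpab hnab' hab
  obtain ⟨g, hg⟩ := hR.exists_lift j g
  rw [← hg] at hga hgb
  obtain ⟨m, hm, hmi, hmj⟩ := hR.exists_mem_min hM i j
  have hne : a ≠ b := fun h => hnab (h ▸ hγ.1.refl a)
  obtain ⟨haM, hbM⟩ := mem_of_le_reesCong hδ hab hne
  refine ⟨.meet ((g.comp p).comp h) (.const ⟨m, hm⟩), fun x y hxy => ?_,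
    fun x => (hM i).meet_right_mem hmi _, fun x => (hM j).meet_right_mem hmj _, ?_, ?_⟩
  · refine hα.2.1 _ _ _ _ ?_ (hα.1.refl _)
    change α (coordEval S R _ i x) (coordEval S R _ i y)
    simp only [coordEval_comp]
    exact coordEval_cong hα g (hpi _ _ (coordEval_cong hβ h hxy))
  · have key : γ (coordEval S R ((g.comp p).comp h) j a) a := by
      simp only [coordEval_comp]
      exact hγ.1.trans (coordEval_cong hγ g hpa) hga
    have := hγ.2.1 _ _ _ _ key (hγ.1.refl (m j))
    rwa [(S j).meet_proj ((hM j).sim haM hmj)] at this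
  · have key : γ (coordEval S R ((g.comp p).comp h) j b) b := by
      simp only [coordEval_comp]
      exact hγ.1.trans (coordEval_cong hγ g hpb) hgb
    have := hγ.2.1 _ _ _ _ key (hγ.1.refl (m j))
    rwa [(S j).meet_proj ((hM j).sim hbM hmj)] at this

/-- Separation is symmetric: among the polynomials not collapsing `β` into `α`, one with the
largest kernel modulo `γ` collapses `δ` into `γ`. -/
theorem SepWrt.symm (hR : SubdirectSMB S R) {M : ∀ i, Set (A i)}
    (hM : ∀ i, (S i).IsMinClass (M i)) {i j : Fin n} [Finite (A j)] {α β : A i → A i → Prop}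
    {γ δ : A j → A j → Prop} (hcα : (S i).IsCover α β) (hβ : CongLE β (reesCong (M i)))
    (hcγ : (S j).IsCover γ δ) (hδ : CongLE δ (reesCong (M j)))
    (hsep : SepWrt S R j γ δ i α β) : SepWrt S R i α β j γ δ := by
  obtain ⟨p, hpj, hpi⟩ := hsep
  have hα := hcα.1
  have hβc := hcα.2.1
  have hγ := hcγ.1
  have hδc := hcγ.2.1
  let ker : PTerm {r : ∀ i, A i // r ∈ R} → Set (A j × A j) := fun q =>
    {z | γ (coordEval S R q j z.1) (coordEval S R q j z.2)}
  obtain ⟨-, ⟨q, hq, rfl⟩, hmax⟩ :=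
    (wellFounded_gt (α := Set (A j × A j))).has_min
      (ker '' {q | ¬ MapsC (coordEval S R q i) β α}) ⟨_, .var, hcα.2.2.2.1, rfl⟩
  refine ⟨q, hq, ?_⟩
  intro a' b' hab'
  by_contra hnab
  have hab := coordEval_cong hδc q hab'
  obtain ⟨P, hPi, hPiM, hPjM, hPa, hPb⟩ :=
    hR.exists_collapsing_retraction hM hα hβc hcγ hδ hpj hpi hab hnab
  have hne : coordEval S R q j a' ≠ coordEval S R q j b' := fun h => hnab (h ▸ hγ.1.refl _)
  obtain ⟨haM, hbM⟩ := mem_of_le_reesCong hδ hab hne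
  have hq' := hq
  unfold MapsC at hq'
  push Not at hq'
  obtain ⟨u, v, huv, hnuv⟩ := hq'
  obtain ⟨c, hc, rfl⟩ := hR.2.2 i u
  let f : PTerm {r : ∀ i, A i // r ∈ R} :=
    .dd q (P.comp q) ((P.comp q).comp (.const ⟨c, hc⟩))
  have hf : ∀ k x, coordEval S R f k x = (S k).d (coordEval S R q k x)
      (coordEval S R P k (coordEval S R q k x))
      (coordEval S R P k (coordEval S R q k (c k))) := by
    intro k x
    change (S k).d (coordEval S R q k x) (coordEval S R (P.comp q) k x)
      (coordEval S R ((P.comp q).comp (.const ⟨c, hc⟩)) k x) = _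
    simp only [coordEval_comp]
    rfl
  refine hmax (ker f) ⟨f, ?_, rfl⟩ ⟨?_, ?_⟩
  · intro hmaps
    apply hnuv
    have hquv := coordEval_cong hβc q huv
    have hne' : coordEval S R q i (c i) ≠ coordEval S R q i v :=
      fun h => hnuv (h ▸ hα.1.refl _)
    obtain ⟨huM, hvM⟩ := mem_of_le_reesCong hβ hquv hne'
    have h := hmaps _ _ huv
    rw [hf, hf, (S i).malcev_right ((hM i).sim (hPiM _) huM)] at h
    refine hα.1.trans h ?_
    have h' := hα.2.2 _ _ _ _ _ _ (hα.1.refl (coordEval S R q i v))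
      (hα.1.refl (coordEval S R P i (coordEval S R q i v))) (hPi _ _ hquv)
    rwa [(S i).malcev_right (b := coordEval S R q i v) ((hM i).sim (hPiM _) hvM)] at h'
  · rintro ⟨x, y⟩ hxy
    change γ _ _ at hxy
    change γ _ _
    rw [hf, hf]
    exact hγ.2.2 _ _ _ _ _ _ hxy (coordEval_cong hγ P hxy) (hγ.1.refl _)
  · intro hle
    refine hnab (hle (a := (a', b')) ?_)
    change γ _ _
    have key : ∀ x, coordEval S R q j x ∈ M j →
        γ (coordEval S R P j (coordEval S R q j x)) (coordEval S R q j x) →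
        γ (coordEval S R f j x) (coordEval S R P j (coordEval S R q j (c j))) := by
      intro x hx hPx
      have h := hγ.2.2 _ _ _ _ _ _ (hγ.1.refl (coordEval S R q j x)) hPx
        (hγ.1.refl (coordEval S R P j (coordEval S R q j (c j))))
      rwa [← hf, (S j).malcev_left ((hM j).sim hx (hPjM _))] at h
    exact hγ.1.trans (key a' haM hPa) (hγ.1.symm (key b' hbM hPb))

end Subdirect

/-- "cannot be separated with respect to `R`" is an equivalence
relation on `I_R` (reflexive, symmetric, and transitive). -/
theorem cannot_separate_equivalence {n : ℕ} {A : Fin n → Type} [∀ i, Fintype (A i)]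
    (S : ∀ i, RegSMB (A i))
    (M : ∀ i, Set (A i)) (hM : ∀ i, SMB.IsMinClass (S i).toSMB (M i))
    (R : Set (∀ i, A i)) (hR : SubdirectSMB (fun i => (S i).toSMB) R) :
    (∀ (i : Fin n) (α β : A i → A i → Prop), InIR S M i α β →
      ¬ SepWrt (fun k => (S k).toSMB) R i α β i α β) ∧
    (∀ (i : Fin n) (α β : A i → A i → Prop) (j : Fin n) (γ δ : A j → A j → Prop),
      InIR S M i α β → InIR S M j γ δ →
      ¬ SepWrt (fun k => (S k).toSMB) R i α β j γ δ →
      ¬ SepWrt (fun k => (S k).toSMB) R j γ δ i α β) ∧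
    (∀ (i : Fin n) (α β : A i → A i → Prop) (j : Fin n) (γ δ : A j → A j → Prop)
      (l : Fin n) (ε ζ : A l → A l → Prop),
      InIR S M i α β → InIR S M j γ δ → InIR S M l ε ζ →
      ¬ SepWrt (fun k => (S k).toSMB) R i α β j γ δ →
      ¬ SepWrt (fun k => (S k).toSMB) R j γ δ l ε ζ →
      ¬ SepWrt (fun k => (S k).toSMB) R i α β l ε ζ) := by
  refine ⟨?_, ?_, ?_⟩
  · rintro i α β - ⟨p, hp, hp'⟩
    exact hp hp'
  · rintro i α β j γ δ ⟨hcα, hβ⟩ ⟨hcγ, hδ⟩ h hsep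
    exact h (hsep.symm hR hM hcα hβ hcγ hδ)
  · rintro i α β j γ δ l ε ζ - - - h h' ⟨p, hp, hp'⟩
    exact h' ⟨p, fun hj => h ⟨p, hp, hj⟩, hp'⟩
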